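/- arXiv:2106.03589 — 2 statements merged into one kernel-verified Lean document; each statement's English description precedes it below -/
import Mathlib

section
/- Implicit regularization (Theorem 3): In the setting of the nonparametric convergence theorem, let α̂(·,t) ∈ L²(Θ,ν;ℝ^{d₁}) denote the density of the adaptive input, defined by ∂α̂/∂t(θ,t) = −γ Φ(x(t),θ)ᵀ g_e(x(t),t)ᵀ ∇Q(e(t),t) with α̂(·,0) = 0, so that u(x,t) = ∫_Θ Φ(x,θ)α̂(θ,t)dν(θ). Define the interpolating set 𝒜̄ := { ᾱ ∈ L²(Θ,ν;ℝ^{d₁}) : ∫_Θ Φ(x(t),θ)ᾱ(θ)dν(θ) = h(x(t)) for all t ≥ 0 }. If α̂(·,t) converges in L²(Θ,ν) as t → ∞ to a limit α̂_∞ ∈ 𝒜̄, then α̂_∞ minimizes the L²(Θ,ν)-norm over 𝒜̄, i.e., ‖α̂_∞‖_{L²(Θ,ν)} ≤ ‖ᾱ‖_{L²(Θ,ν)} for every ᾱ ∈ 𝒜̄. -/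
open MeasureTheory Filter Set
open scoped RealInnerProductSpace ENNReal

noncomputable section

/-- A class-`K∞` function: continuous, strictly increasing on `[0,∞)`, vanishing at `0`,
and tending to `∞`. -/
def IsClassKInfty (ρ : ℝ → ℝ) : Prop :=
  ContinuousOn ρ (Set.Ici 0) ∧ StrictMonoOn ρ (Set.Ici 0) ∧ ρ 0 = 0 ∧
    Filter.Tendsto ρ Filter.atTop Filter.atTop

/-- Locally Lipschitz in the first argument, uniformly over compact time intervals. -/
def LocLipschitzInX {E F : Type*} [NormedAddCommGroup E] [NormedAddCommGroup F]
    (f : E → ℝ → F) : Prop :=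
  ∀ T R : ℝ, 0 < T → 0 < R → ∃ C : ℝ, ∀ t ∈ Set.Icc (0 : ℝ) T, ∀ x y : E,
    ‖x‖ ≤ R → ‖y‖ ≤ R → ‖f x t - f y t‖ ≤ C * ‖x - y‖

/-- Locally bounded in the first argument, uniformly in `t ≥ 0`. -/
def LocBoundedInXUnifT {E F : Type*} [NormedAddCommGroup E] [NormedAddCommGroup F]
    (f : E → ℝ → F) : Prop :=
  ∀ R : ℝ, 0 < R → ∃ C : ℝ, ∀ t : ℝ, 0 ≤ t → ∀ x : E, ‖x‖ ≤ R → ‖f x t‖ ≤ C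

/-- The nonparametric adaptive input
`u(y,t) = −γ ∫₀ᵗ 𝖪(y, x(τ)) g_e(x(τ),τ)ᵀ ∇Q(e(τ),τ) dτ`, where
`𝖪(y,z) = ∫_Θ Φ(y,θ)Φ(z,θ)ᵀ dν(θ)`, evaluated along candidate trajectories
`X` (state) and `Eb` (error). -/
def npInput {n s d d₁ : ℕ} {Θ : Type*} [MeasurableSpace Θ] (ν : Measure Θ)
    (Φ : EuclideanSpace ℝ (Fin n) → Θ →
      (EuclideanSpace ℝ (Fin d₁) →L[ℝ] EuclideanSpace ℝ (Fin d)))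
    (ge : EuclideanSpace ℝ (Fin n) → ℝ →
      (EuclideanSpace ℝ (Fin d) →L[ℝ] EuclideanSpace ℝ (Fin s)))
    (gradQ : EuclideanSpace ℝ (Fin s) → ℝ → EuclideanSpace ℝ (Fin s))
    (γ : ℝ) (X : ℝ → EuclideanSpace ℝ (Fin n)) (Eb : ℝ → EuclideanSpace ℝ (Fin s))
    (y : EuclideanSpace ℝ (Fin n)) (t : ℝ) : EuclideanSpace ℝ (Fin d) :=
  (-γ) • ∫ τ in (0 : ℝ)..t, ∫ θ,
    (Φ y θ) ((ContinuousLinearMap.adjoint (Φ (X τ) θ))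
      ((ContinuousLinearMap.adjoint (ge (X τ) τ)) (gradQ (Eb τ) τ))) ∂ν

/-- The pair `(X, Eb)` is a solution of the closed-loop system driven by the
nonparametric adaptive input. -/
def SolvesClosedLoop {n s d d₁ : ℕ} {Θ : Type*} [MeasurableSpace Θ] (ν : Measure Θ)
    (Φ : EuclideanSpace ℝ (Fin n) → Θ →
      (EuclideanSpace ℝ (Fin d₁) →L[ℝ] EuclideanSpace ℝ (Fin d)))
    (f : EuclideanSpace ℝ (Fin n) → ℝ → EuclideanSpace ℝ (Fin n))
    (g : EuclideanSpace ℝ (Fin n) → ℝ →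
      (EuclideanSpace ℝ (Fin d) →L[ℝ] EuclideanSpace ℝ (Fin n)))
    (h : EuclideanSpace ℝ (Fin n) → EuclideanSpace ℝ (Fin d))
    (fe : EuclideanSpace ℝ (Fin s) → ℝ → EuclideanSpace ℝ (Fin s))
    (ge : EuclideanSpace ℝ (Fin n) → ℝ →
      (EuclideanSpace ℝ (Fin d) →L[ℝ] EuclideanSpace ℝ (Fin s)))
    (gradQ : EuclideanSpace ℝ (Fin s) → ℝ → EuclideanSpace ℝ (Fin s))
    (γ : ℝ) (x₀ : EuclideanSpace ℝ (Fin n)) (e₀ : EuclideanSpace ℝ (Fin s))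
    (X : ℝ → EuclideanSpace ℝ (Fin n)) (Eb : ℝ → EuclideanSpace ℝ (Fin s)) : Prop :=
  X 0 = x₀ ∧ Eb 0 = e₀ ∧
  (∀ t : ℝ, 0 ≤ t → HasDerivAt X
    (f (X t) t + (g (X t) t) (npInput ν Φ ge gradQ γ X Eb (X t) t - h (X t))) t) ∧
  (∀ t : ℝ, 0 ≤ t → HasDerivAt Eb
    (fe (Eb t) t + (ge (X t) t) (npInput ν Φ ge gradQ γ X Eb (X t) t - h (X t))) t)

/-- Everywhere-measurable version of the density argument: a Carathéodory family whose time
derivative has uniformly bounded `L¹` norm and zero mean keeps zero mean. -/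
theorem zero_mean_aux {Θ : Type*} [MeasurableSpace Θ] (ν : Measure Θ) [IsProbabilityMeasure ν]
    (F D : Θ → ℝ → ℝ) (T : ℝ) (hT : 0 ≤ T) (M : ℝ≥0∞) (hM : M ≠ ∞)
    (hF0 : ∀ θ, F θ 0 = 0)
    (hFD : ∀ θ t, 0 ≤ t → HasDerivAt (F θ) (D θ t) t)
    (hFm : ∀ t, 0 ≤ t → AEStronglyMeasurable (fun θ => F θ t) ν)
    (hDb : ∀ t, 0 ≤ t → t ≤ T → ∫⁻ θ, ‖D θ t‖ₑ ∂ν ≤ M)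
    (hD0 : ∀ t, 0 ≤ t → t ≤ T → ∫ θ, D θ t ∂ν = 0) :
    ∫ θ, F θ T ∂ν = 0 := by
  classical
  -- a measurable set of full measure on which the family is measurable
  have hq : ∀ᵐ θ ∂ν, ∀ q : ℚ, F θ (max (q : ℝ) 0) =
      (hFm (max (q : ℝ) 0) (le_max_right _ _)).mk _ θ := by
    rw [ae_all_iff]
    intro q
    exact (hFm (max (q : ℝ) 0) (le_max_right _ _)).ae_eq_mk
  obtain ⟨S, hS, hSm, hSν⟩ : ∃ S : Set Θ, (∀ θ ∈ S, ∀ q : ℚ, F θ (max (q : ℝ) 0) =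
      (hFm (max (q : ℝ) 0) (le_max_right _ _)).mk _ θ) ∧ MeasurableSet S ∧ ∀ᵐ θ ∂ν, θ ∈ S := by
    obtain ⟨N, hN1, hN2, hN3⟩ := exists_measurable_superset_of_null (ae_iff.1 hq)
    refine ⟨Nᶜ, ?_, hN2.compl, ?_⟩
    · intro θ hθ
      by_contra hc
      exact hθ (hN1 hc)
    · rw [ae_iff]
      simpa using hN3
  set F' : ℝ → Θ → ℝ := fun t => S.indicator (fun θ => F θ (max t 0)) with hF'
  have hcont : ∀ θ, Continuous fun t => F' t θ := by
    intro θ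
    by_cases hθ : θ ∈ S
    · simp only [hF', Set.indicator_of_mem hθ]
      rw [continuous_iff_continuousAt]
      intro t
      have h1 := (hFD θ (max t 0) (le_max_right _ _)).continuousAt
      exact ContinuousAt.comp (f := fun t : ℝ => max t 0) (g := F θ) h1
        (by fun_prop)
    · simp only [hF', Set.indicator_of_notMem hθ]
      exact continuous_const
  have hmeasq : ∀ q : ℚ, Measurable (F' q) := by
    intro q
    have h1 : F' q = S.indicator ((hFm (max (q : ℝ) 0) (le_max_right _ _)).mk _) := by
      apply Set.indicator_congr
      intro θ hθ
      exact hS θ hθ q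
    rw [h1]
    exact (hFm (max (q : ℝ) 0) (le_max_right _ _)).stronglyMeasurable_mk.measurable.indicator hSm
  have hmeas : ∀ t : ℝ, Measurable (F' t) := by
    intro t
    obtain ⟨u, -, -, hu⟩ := Rat.isDenseEmbedding_coe_real.dense.exists_seq_strictMono_tendsto
      Rat.cast_mono t
    refine measurable_of_tendsto_metrizable (f := fun k => F' (u k)) (fun k => hmeasq _) ?_
    rw [tendsto_pi_nhds]
    intro θ
    exact ((hcont θ).tendsto t).comp hu
  have hFu : Measurable (Function.uncurry F') :=
    measurable_uncurry_of_continuous_of_measurable hcont hmeas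
  -- the derivative is jointly measurable
  set D' : ℝ × Θ → ℝ := (Ici (0 : ℝ) ×ˢ S).indicator (fun p => D p.2 p.1) with hD'
  have hD'm : Measurable D' := by
    refine measurable_of_tendsto_metrizable
      (f := fun (k : ℕ) => (Ici (0 : ℝ) ×ˢ S).indicator (fun p : ℝ × Θ =>
        (((k : ℝ) + 1)⁻¹)⁻¹ • (F' (p.1 + ((k : ℝ) + 1)⁻¹) p.2 - F' p.1 p.2))) ?_ ?_
    · intro k
      refine Measurable.indicator ?_ (measurableSet_Ici.prod hSm)
      simp only [smul_eq_mul]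
      refine Measurable.const_mul ?_ _
      refine Measurable.sub ?_ hFu
      exact hFu.comp (f := fun p : ℝ × Θ => (p.1 + ((k : ℝ) + 1)⁻¹, p.2)) (by fun_prop)
    · rw [tendsto_pi_nhds]
      rintro ⟨t, θ⟩
      by_cases hp : (t, θ) ∈ Ici (0 : ℝ) ×ˢ S
      · have ht : 0 ≤ t := hp.1
        have hθ : θ ∈ S := hp.2
        simp only [hD', Set.indicator_of_mem hp]
        have hs := (hFD θ t ht).tendsto_slope_zero_right
        have h0 : Tendsto (fun k : ℕ => ((k : ℝ) + 1)⁻¹) atTop (nhdsWithin 0 (Ioi 0)) := by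
          rw [tendsto_nhdsWithin_iff]
          refine ⟨?_, Eventually.of_forall fun k => ?_⟩
          · simpa using tendsto_one_div_add_atTop_nhds_zero_nat (𝕜 := ℝ)
          · simp only [mem_Ioi]; positivity
        refine (hs.comp h0).congr ?_
        intro k
        have hk : (0 : ℝ) ≤ t + ((k : ℝ) + 1)⁻¹ := by positivity
        simp only [Function.comp, hF', Set.indicator_of_mem hθ, max_eq_left hk, max_eq_left ht]
      · simp only [hD', Set.indicator_of_notMem hp]
        exact tendsto_const_nhds
  set lam : Measure ℝ := volume.restrict (Ioc 0 T) with hlam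
  have hslice : ∀ t, 0 ≤ t → ∀ᵐ θ ∂ν, D' (t, θ) = D θ t := by
    intro t ht
    filter_upwards [hSν] with θ hθ
    have hp : (t, θ) ∈ Ici (0 : ℝ) ×ˢ S := ⟨ht, hθ⟩
    simp only [hD', Set.indicator_of_mem hp]
  have hint : Integrable D' (lam.prod ν) := by
    refine ⟨hD'm.aestronglyMeasurable, ?_⟩
    rw [hasFiniteIntegral_iff_enorm, lintegral_prod _ hD'm.enorm.aemeasurable]
    calc ∫⁻ t, ∫⁻ θ, ‖D' (t, θ)‖ₑ ∂ν ∂lam ≤ ∫⁻ t, M ∂lam := by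
          refine setLIntegral_mono measurable_const ?_
          intro t ht
          rw [lintegral_congr_ae (g := fun θ => ‖D θ t‖ₑ)]
          · exact hDb t ht.1.le ht.2
          · filter_upwards [hslice t ht.1.le] with θ hθ
            rw [hθ]
      _ < ∞ := by
          rw [lintegral_const]
          refine ENNReal.mul_lt_top hM.lt_top ?_
          simp [hlam]
  have hFT : ∀ᵐ θ ∂ν, F θ T = ∫ t, D' (t, θ) ∂lam := by
    filter_upwards [hSν, hint.prod_left_ae] with θ hθ hi
    have heq : ∀ t ∈ Ioc 0 T, D' (t, θ) = D θ t := by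
      intro t ht
      have hp : (t, θ) ∈ Ici (0 : ℝ) ×ˢ S := ⟨ht.1.le, hθ⟩
      simp only [hD', Set.indicator_of_mem hp]
    have hi2 : IntervalIntegrable (D θ) volume 0 T := by
      rw [intervalIntegrable_iff_integrableOn_Ioc_of_le hT]
      exact IntegrableOn.congr_fun hi heq measurableSet_Ioc
    have h1 := intervalIntegral.integral_eq_sub_of_hasDerivAt (f := F θ) (f' := D θ) (a := 0) (b := T)
      (fun t ht => hFD θ t (by rw [uIcc_of_le hT] at ht; exact ht.1)) hi2
    rw [hF0, sub_zero, intervalIntegral.integral_of_le hT] at h1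
    rw [← h1]
    exact (setIntegral_congr_fun measurableSet_Ioc heq).symm
  rw [integral_congr_ae hFT]
  rw [← integral_integral_swap (f := fun t θ => D' (t, θ)) hint]
  rw [hlam, setIntegral_congr_fun (g := fun _ => (0 : ℝ)) measurableSet_Ioc]
  · simp
  · intro t ht
    show ∫ θ, D' (t, θ) ∂ν = 0
    rw [integral_congr_ae (hslice t ht.1.le)]
    exact hD0 t ht.1.le ht.2

/-- If `a_t → a` in `L²`, all `a_t` are orthogonal to `b - a`, then `‖a‖ ≤ ‖b‖`. -/
theorem min_norm_aux {Θ : Type*} [MeasurableSpace Θ] (ν : Measure Θ) {d₁ : ℕ}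
    (A : Θ → ℝ → EuclideanSpace ℝ (Fin d₁)) (a b : Θ → EuclideanSpace ℝ (Fin d₁))
    (hA : ∀ t : ℝ, 0 ≤ t → MemLp (fun θ => A θ t) 2 ν) (ha : MemLp a 2 ν) (hb : MemLp b 2 ν)
    (hconv : Tendsto (fun t => eLpNorm (fun θ => A θ t - a θ) 2 ν) atTop (nhds 0))
    (horth : ∀ t, 0 ≤ t → ∫ θ, ⟪A θ t, b θ - a θ⟫ ∂ν = 0) :
    eLpNorm a 2 ν ≤ eLpNorm b 2 ν := by
  set a' := ha.toLp a with ha'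
  set b' := hb.toLp b with hb'
  have hbd : ∀ t, 0 ≤ t → ‖⟪a', b' - a'⟫‖ ≤
      (eLpNorm (fun θ => A θ t - a θ) 2 ν).toReal * ‖b' - a'‖ := by
    intro t ht
    have h0 : ⟪(hA t ht).toLp _, b' - a'⟫ = 0 := by
      rw [L2.inner_def, ← horth t ht, hb', ha', ← MemLp.toLp_sub]
      apply integral_congr_ae
      filter_upwards [(hA t ht).coeFn_toLp, (hb.sub ha).coeFn_toLp] with θ h1 h2
      rw [h1, h2]; rfl
    have h1 : ⟪a', b' - a'⟫ = - ⟪(hA t ht).toLp _ - a', b' - a'⟫ := by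
      rw [inner_sub_left, h0]; ring
    rw [h1, norm_neg]
    refine (norm_inner_le_norm _ _).trans_eq ?_
    rw [ha', ← MemLp.toLp_sub, Lp.norm_toLp]
    rfl
  have hz : ‖⟪a', b' - a'⟫‖ ≤ 0 := by
    have h1 : Tendsto (fun t => (eLpNorm (fun θ => A θ t - a θ) 2 ν).toReal * ‖b' - a'‖)
        atTop (nhds 0) := by
      have h2 := (ENNReal.tendsto_toReal (ENNReal.zero_ne_top)).comp hconv
      simpa using h2.mul_const ‖b' - a'‖
    refine ge_of_tendsto h1 ?_
    filter_upwards [eventually_ge_atTop 0] with t ht using hbd t ht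
  have hz' : ⟪a', b' - a'⟫ = 0 := norm_le_zero_iff.1 hz
  have hn : ‖a'‖ ≤ ‖b'‖ := by
    have h1 := norm_add_sq_real a' (b' - a')
    rw [hz', add_sub_cancel] at h1
    have : ‖a'‖ ^ 2 ≤ ‖b'‖ ^ 2 := by nlinarith [sq_nonneg ‖b' - a'‖]
    exact le_of_sq_le_sq this (norm_nonneg _)
  rw [ha', hb', Lp.norm_toLp, Lp.norm_toLp] at hn
  exact (ENNReal.toReal_le_toReal ha.2.ne hb.2.ne).1 hn

theorem enorm_inner_aux {d : ℕ} (v w : EuclideanSpace ℝ (Fin d)) :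
    ‖⟪v, w⟫‖ₑ ≤ ‖v‖ₑ * ‖w‖ₑ := by
  rw [← ofReal_norm, ← ofReal_norm v, ← ofReal_norm w, ← ENNReal.ofReal_mul (norm_nonneg _)]
  exact ENNReal.ofReal_le_ofReal (norm_inner_le_norm _ _)

theorem eLpNorm_tri_aux {Θ E : Type*} [MeasurableSpace Θ] [NormedAddCommGroup E] (ν : Measure Θ)
    (a b : Θ → E) (ha : AEStronglyMeasurable a ν) (hb : AEStronglyMeasurable b ν) :
    eLpNorm a 2 ν ≤ eLpNorm (fun θ => a θ - b θ) 2 ν + eLpNorm b 2 ν := by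
  have h := eLpNorm_add_le (p := 2) (ha.sub hb) hb (by norm_num)
  rw [sub_add_cancel] at h
  exact h

theorem integrable_apply_aux {Θ E F : Type*} [MeasurableSpace Θ] [NormedAddCommGroup E]
    [NormedSpace ℝ E] [NormedAddCommGroup F] [NormedSpace ℝ F] (ν : Measure Θ)
    (L : Θ → E →L[ℝ] F) (b : Θ → E) (hL : MemLp L 2 ν) (hb : MemLp b 2 ν) :
    Integrable (fun θ => L θ (b θ)) ν := by
  refine Integrable.mono' (hL.norm.integrable_mul hb.norm) ?_ ?_
  · exact (ContinuousLinearMap.id ℝ (E →L[ℝ] F)).aestronglyMeasurable_comp₂ hL.1 hb.1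
  · exact Eventually.of_forall fun θ => (L θ).le_opNorm _

set_option maxHeartbeats 1000000 in
/-- **Implicit regularization (Theorem 3).**
In the setting of the nonparametric convergence theorem, let `αhat(·,t) ∈ L²(Θ,ν)`
be the density of the adaptive input, defined pointwise in `θ` by
`∂αhat/∂t(θ,t) = −γ Φ(x(t),θ)ᵀ g_e(x(t),t)ᵀ ∇Q(e(t),t)`, `αhat(·,0) = 0`, so that
`u(y,t) = ∫_Θ Φ(y,θ) αhat(θ,t) dν(θ)`. If `αhat(·,t) → αinf` in `L²(Θ,ν)` as `t → ∞`
with `αinf` in the interpolating set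
`𝒜̄ = {ᾱ ∈ L² : ∫ Φ(x(t),θ)ᾱ(θ)dν = h(x(t)) ∀ t ≥ 0}`, then `αinf` has minimal
`L²(Θ,ν)`-norm among all elements of `𝒜̄`. -/
theorem implicit_regularization
    {n s d d₁ : ℕ} {Θ : Type*} [MeasurableSpace Θ]
    (ν : Measure Θ) [IsProbabilityMeasure ν]
    (f : EuclideanSpace ℝ (Fin n) → ℝ → EuclideanSpace ℝ (Fin n))
    (g : EuclideanSpace ℝ (Fin n) → ℝ →
      (EuclideanSpace ℝ (Fin d) →L[ℝ] EuclideanSpace ℝ (Fin n)))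
    (h : EuclideanSpace ℝ (Fin n) → EuclideanSpace ℝ (Fin d))
    (fe : EuclideanSpace ℝ (Fin s) → ℝ → EuclideanSpace ℝ (Fin s))
    (ge : EuclideanSpace ℝ (Fin n) → ℝ →
      (EuclideanSpace ℝ (Fin d) →L[ℝ] EuclideanSpace ℝ (Fin s)))
    (xd : ℝ → EuclideanSpace ℝ (Fin n))
    (hxd : ∃ C : ℝ, ∀ t : ℝ, 0 ≤ t → ‖xd t‖ ≤ C)
    -- Assumption 1 (dynamics regularity)
    (hf_lip : LocLipschitzInX f) (hf_bd : LocBoundedInXUnifT f)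
    (hg_lip : LocLipschitzInX g) (hg_bd : LocBoundedInXUnifT g)
    (hh_lip : LocLipschitzInX fun x (_ : ℝ) => h x)
    (hh_bd : LocBoundedInXUnifT fun x (_ : ℝ) => h x)
    -- Assumption 2 (error regularity)
    (hfe_lip : LocLipschitzInX fe) (hfe_bd : LocBoundedInXUnifT fe)
    (hge_lip : LocLipschitzInX ge) (hge_bd : LocBoundedInXUnifT ge)
    (hfe0 : ∀ t : ℝ, 0 ≤ t → fe 0 t = 0)
    (herr_bdd : ∀ (X : ℝ → EuclideanSpace ℝ (Fin n)) (Eb : ℝ → EuclideanSpace ℝ (Fin s))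
        (w : ℝ → EuclideanSpace ℝ (Fin d)),
      (∀ t : ℝ, 0 ≤ t → HasDerivAt X (f (X t) t + (g (X t) t) (w t)) t) →
      (∀ t : ℝ, 0 ≤ t → HasDerivAt Eb (fe (Eb t) t + (ge (X t) t) (w t)) t) →
      ∀ T : ℝ, 0 < T → (∃ C : ℝ, ∀ t ∈ Set.Icc (0 : ℝ) T, ‖Eb t‖ ≤ C) →
        ∃ C : ℝ, ∀ t ∈ Set.Icc (0 : ℝ) T, ‖X t - xd t‖ ≤ C)
    (herr_conv : ∀ (X : ℝ → EuclideanSpace ℝ (Fin n)) (Eb : ℝ → EuclideanSpace ℝ (Fin s))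
        (w : ℝ → EuclideanSpace ℝ (Fin d)),
      (∀ t : ℝ, 0 ≤ t → HasDerivAt X (f (X t) t + (g (X t) t) (w t)) t) →
      (∀ t : ℝ, 0 ≤ t → HasDerivAt Eb (fe (Eb t) t + (ge (X t) t) (w t)) t) →
      Filter.Tendsto (fun t => ‖Eb t‖) Filter.atTop (nhds 0) →
        Filter.Tendsto (fun t => ‖X t - xd t‖) Filter.atTop (nhds 0))
    -- Assumption 3 (Lyapunov stability of the error)
    (Q : EuclideanSpace ℝ (Fin s) → ℝ → ℝ)
    (gradQ : EuclideanSpace ℝ (Fin s) → ℝ → EuclideanSpace ℝ (Fin s))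
    (dtQ : EuclideanSpace ℝ (Fin s) → ℝ → ℝ)
    (hQgrad : ∀ (e : EuclideanSpace ℝ (Fin s)) (t : ℝ),
      HasGradientAt (fun y => Q y t) (gradQ e t) e)
    (hQdt : ∀ (e : EuclideanSpace ℝ (Fin s)) (t : ℝ), HasDerivAt (fun τ => Q e τ) (dtQ e t) t)
    (hgradQ_bd : LocBoundedInXUnifT gradQ) (hdtQ_bd : LocBoundedInXUnifT dtQ)
    (hgradQ_lip : LocLipschitzInX gradQ)
    (ρ μ₁ μ₂ : ℝ → ℝ)
    (hρ : IsClassKInfty ρ) (hμ₁ : IsClassKInfty μ₁) (hμ₂ : IsClassKInfty μ₂)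
    (hdecr : ∀ (e : EuclideanSpace ℝ (Fin s)) (t : ℝ), 0 ≤ t →
      ⟪gradQ e t, fe e t⟫ + dtQ e t ≤ -ρ ‖e‖)
    (hsandwich : ∀ (e : EuclideanSpace ℝ (Fin s)) (t : ℝ), 0 ≤ t →
      μ₁ ‖e‖ ≤ Q e t ∧ Q e t ≤ μ₂ ‖e‖)
    -- Assumptions 4 & 5 (the function class ℱ₂ and second moment regularity of Φ)
    (Φ : EuclideanSpace ℝ (Fin n) → Θ →
      (EuclideanSpace ℝ (Fin d₁) →L[ℝ] EuclideanSpace ℝ (Fin d)))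
    (hΦ_meas : ∀ x : EuclideanSpace ℝ (Fin n), AEStronglyMeasurable (fun θ => Φ x θ) ν)
    (hΦ_sq : ∀ x : EuclideanSpace ℝ (Fin n), Integrable (fun θ => ‖Φ x θ‖ ^ 2) ν)
    (hΦ_lip : ∀ R : ℝ, 0 < R → ∃ C : ℝ, ∀ x y : EuclideanSpace ℝ (Fin n),
      ‖x‖ ≤ R → ‖y‖ ≤ R →
        Real.sqrt (∫ θ, ‖Φ x θ - Φ y θ‖ ^ 2 ∂ν) ≤ C * ‖x - y‖)
    (α : Θ → EuclideanSpace ℝ (Fin d₁)) (hα : MemLp α 2 ν)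
    (hhrep : ∀ x : EuclideanSpace ℝ (Fin n), h x = ∫ θ, (Φ x θ) (α θ) ∂ν)
    -- learning rate and initial conditions
    (γ : ℝ) (hγ : 0 < γ)
    (x₀ : EuclideanSpace ℝ (Fin n)) (e₀ : EuclideanSpace ℝ (Fin s))
    -- the closed-loop solution
    (X : ℝ → EuclideanSpace ℝ (Fin n)) (Eb : ℝ → EuclideanSpace ℝ (Fin s))
    (hsol : SolvesClosedLoop ν Φ f g h fe ge gradQ γ x₀ e₀ X Eb)
    -- the density of the adaptive input
    (αhat : Θ → ℝ → EuclideanSpace ℝ (Fin d₁))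
    (hαhat0 : ∀ θ : Θ, αhat θ 0 = 0)
    (hαhatODE : ∀ (θ : Θ) (t : ℝ), 0 ≤ t → HasDerivAt (αhat θ)
      ((-γ) • (ContinuousLinearMap.adjoint (Φ (X t) θ))
        ((ContinuousLinearMap.adjoint (ge (X t) t)) (gradQ (Eb t) t))) t)
    (hαhatL2 : ∀ t : ℝ, 0 ≤ t → MemLp (fun θ => αhat θ t) 2 ν)
    (hurep : ∀ (y : EuclideanSpace ℝ (Fin n)) (t : ℝ), 0 ≤ t →
      npInput ν Φ ge gradQ γ X Eb y t = ∫ θ, (Φ y θ) (αhat θ t) ∂ν)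
    -- L² convergence of the density to a limit lying in the interpolating set
    (αinf : Θ → EuclideanSpace ℝ (Fin d₁)) (hαinf : MemLp αinf 2 ν)
    (hαconv : Filter.Tendsto (fun t => eLpNorm (fun θ => αhat θ t - αinf θ) 2 ν)
      Filter.atTop (nhds 0))
    (hαinf_interp : ∀ t : ℝ, 0 ≤ t → (∫ θ, (Φ (X t) θ) (αinf θ) ∂ν) = h (X t)) :
    -- conclusion: αinf is the minimum-norm interpolant
    ∀ ᾱ : Θ → EuclideanSpace ℝ (Fin d₁), MemLp ᾱ 2 ν →
      (∀ t : ℝ, 0 ≤ t → (∫ θ, (Φ (X t) θ) (ᾱ θ) ∂ν) = h (X t)) →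
      eLpNorm αinf 2 ν ≤ eLpNorm ᾱ 2 ν := by
  intro ᾱ hᾱ hinterp
  obtain ⟨-, -, hX, hE⟩ := hsol
  refine min_norm_aux ν αhat αinf ᾱ hαhatL2 hαinf hᾱ hαconv ?_
  intro T hT
  have hβ : MemLp (fun θ => ᾱ θ - αinf θ) 2 ν := hᾱ.sub hαinf
  have hΦL : ∀ x, MemLp (fun θ => Φ x θ) 2 ν := fun x =>
    (memLp_two_iff_integrable_sq_norm (hΦ_meas x)).2 (hΦ_sq x)
  have hΦint : ∀ (x) (b : Θ → EuclideanSpace ℝ (Fin d₁)), MemLp b 2 ν →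
      Integrable (fun θ => Φ x θ (b θ)) ν := by
    intro x b hb
    exact integrable_apply_aux ν _ _ (hΦL x) hb
  -- bounds along the trajectory
  have hXc : ContinuousOn X (Icc 0 T) := fun t ht => (hX t ht.1).continuousAt.continuousWithinAt
  have hEc : ContinuousOn Eb (Icc 0 T) := fun t ht => (hE t ht.1).continuousAt.continuousWithinAt
  obtain ⟨R1, hR1⟩ := isCompact_Icc.exists_bound_of_continuousOn hXc
  obtain ⟨R2, hR2⟩ := isCompact_Icc.exists_bound_of_continuousOn hEc
  have hR1' : ∀ t ∈ Icc 0 T, ‖X t‖ ≤ max R1 1 := fun t ht => (hR1 t ht).trans (le_max_left _ _)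
  have hR2' : ∀ t ∈ Icc 0 T, ‖Eb t‖ ≤ max R2 1 := fun t ht => (hR2 t ht).trans (le_max_left _ _)
  have hp1 : 0 < max R1 1 := lt_max_of_lt_right one_pos
  have hp2 : 0 < max R2 1 := lt_max_of_lt_right one_pos
  obtain ⟨C1, hC1⟩ := hge_bd _ hp1
  obtain ⟨C2, hC2⟩ := hgradQ_bd _ hp2
  obtain ⟨C3, hC3⟩ := hΦ_lip _ hp1
  set v : ℝ → EuclideanSpace ℝ (Fin d) := fun t =>
    (ContinuousLinearMap.adjoint (ge (X t) t)) (gradQ (Eb t) t) with hv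
  have hvb : ∀ t ∈ Icc 0 T, ‖v t‖ ≤ C1 * C2 := by
    intro t ht
    have h1 := hC1 t ht.1 _ (hR1' t ht)
    have h2 := hC2 t ht.1 _ (hR2' t ht)
    refine ((ContinuousLinearMap.adjoint (ge (X t) t)).le_opNorm _).trans ?_
    rw [LinearIsometryEquiv.norm_map]
    exact mul_le_mul h1 h2 (norm_nonneg _) ((norm_nonneg _).trans h1)
  have hLip : ∀ x, ‖x‖ ≤ max R1 1 → eLpNorm (fun θ => Φ x θ) 2 ν ≤
      ENNReal.ofReal (|C3| * max R1 1) + eLpNorm (fun θ => Φ 0 θ) 2 ν := by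
    intro x hx
    have h1 : eLpNorm (fun θ => Φ x θ - Φ 0 θ) 2 ν ≤ ENNReal.ofReal (|C3| * max R1 1) := by
      have hm : MemLp (fun θ => Φ x θ - Φ 0 θ) 2 ν := (hΦL x).sub (hΦL 0)
      have h2 := hC3 x 0 hx (by simp)
      rw [hm.eLpNorm_eq_integral_rpow_norm (by norm_num) (by norm_num)]
      apply ENNReal.ofReal_le_ofReal
      rw [Real.sqrt_eq_rpow, sub_zero] at h2
      have h3 : C3 * ‖x‖ ≤ |C3| * max R1 1 :=
        mul_le_mul (le_abs_self _) hx (norm_nonneg _) (abs_nonneg _)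
      refine le_trans (le_of_eq ?_) (h2.trans h3)
      norm_num
    exact (eLpNorm_tri_aux ν _ _ (hΦ_meas x) (hΦ_meas 0)).trans (add_le_add_left h1 _)
  refine zero_mean_aux ν (fun θ t => ⟪αhat θ t, ᾱ θ - αinf θ⟫)
    (fun θ t => -γ * ⟪v t, Φ (X t) θ (ᾱ θ - αinf θ)⟫) T hT
    (‖γ‖ₑ * ENNReal.ofReal (C1 * C2) * ((ENNReal.ofReal (|C3| * max R1 1) +
      eLpNorm (fun θ => Φ 0 θ) 2 ν) * eLpNorm (fun θ => ᾱ θ - αinf θ) 2 ν)) ?_ ?_ ?_ ?_ ?_ ?_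
  · refine ENNReal.mul_ne_top (ENNReal.mul_ne_top enorm_ne_top ENNReal.ofReal_ne_top)
      (ENNReal.mul_ne_top (ENNReal.add_ne_top.2 ⟨ENNReal.ofReal_ne_top, (hΦL 0).2.ne⟩) hβ.2.ne)
  · intro θ
    simp [hαhat0]
  · intro θ t ht
    have h1 := (hαhatODE θ t ht).inner ℝ (hasDerivAt_const t (ᾱ θ - αinf θ))
    rw [inner_zero_right, zero_add, inner_smul_left, ContinuousLinearMap.adjoint_inner_left] at h1
    exact h1
  · intro t ht
    exact (hαhatL2 t ht).1.inner hβ.1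
  · intro t ht htT
    have hmem : t ∈ Icc 0 T := ⟨ht, htT⟩
    calc ∫⁻ θ, ‖-γ * ⟪v t, Φ (X t) θ (ᾱ θ - αinf θ)⟫‖ₑ ∂ν
        ≤ ∫⁻ θ, ‖γ‖ₑ * ENNReal.ofReal (C1 * C2) * (‖Φ (X t) θ‖ₑ * ‖ᾱ θ - αinf θ‖ₑ) ∂ν := by
          apply lintegral_mono
          intro θ
          simp only
          rw [enorm_mul, enorm_neg, mul_assoc]
          gcongr
          have h1 : ‖⟪v t, Φ (X t) θ (ᾱ θ - αinf θ)⟫‖ₑ ≤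
              ‖v t‖ₑ * ‖Φ (X t) θ (ᾱ θ - αinf θ)‖ₑ := by
            exact enorm_inner_aux _ _
          refine h1.trans ?_
          gcongr
          · rw [← ofReal_norm]
            exact ENNReal.ofReal_le_ofReal (hvb t hmem)
          · exact (Φ (X t) θ).le_opENorm _
      _ = ‖γ‖ₑ * ENNReal.ofReal (C1 * C2) * ∫⁻ θ, ‖Φ (X t) θ‖ₑ * ‖ᾱ θ - αinf θ‖ₑ ∂ν := by
          rw [lintegral_const_mul']
          exact ENNReal.mul_ne_top enorm_ne_top ENNReal.ofReal_ne_top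
      _ ≤ _ := by
          gcongr
          have h2 := ENNReal.lintegral_mul_le_Lp_mul_Lq ν Real.HolderConjugate.two_two
            (hΦ_meas (X t)).enorm hβ.1.enorm
          have h3 := hLip _ (hR1' t hmem)
          rw [eLpNorm_eq_lintegral_rpow_enorm_toReal (by norm_num) (by norm_num)] at h3
          rw [eLpNorm_eq_lintegral_rpow_enorm_toReal (f := fun θ => ᾱ θ - αinf θ)
            (by norm_num) (by norm_num)]
          refine h2.trans ?_
          simp only [ENNReal.toReal_ofNat] at h3 ⊢
          gcongr
  · intro t ht htT
    rw [integral_const_mul, integral_inner (hΦint _ _ hβ)]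
    have h1 : ∫ θ, Φ (X t) θ (ᾱ θ - αinf θ) ∂ν = 0 := by
      simp only [map_sub]
      rw [integral_sub (hΦint _ _ hᾱ) (hΦint _ _ hαinf), hinterp t ht, hαinf_interp t ht, sub_self]
    rw [h1, inner_zero_right, mul_zero]

end
end

section
/- Local Lipschitzness of the infinite-dimensional closed-loop vector field (Lemma): Let E := ℝⁿ × ℝˢ × L²(Θ,ν;ℝ^{d₁}) be the Banach space with norm ‖(x,e,α̂)‖_E := max{‖x‖₂, ‖e‖₂, ‖α̂‖_{L²(Θ,ν)}}, and define F : E × [0,∞) → E by F((x,e,α̂), t) := ( f(x,t) + g(x,t)(∫_Θ Φ(x,θ)α̂(θ)dν(θ) − h(x)), f_e(e,t) + g_e(x,t)(∫_Θ Φ(x,θ)α̂(θ)dν(θ) − h(x)), −γ Φ(x,·)ᵀ g_e(x,t)ᵀ ∇Q(e,t) ). Then F is locally Lipschitz in z = (x,e,α̂) with respect to ‖·‖_E: for every R > 0 and T > 0, sup_{t∈[0,T]} sup_{z₁,z₂ ∈ B_E(R), z₁≠z₂} ‖F(z₁,t) − F(z₂,t)‖_E / ‖z₁ − z₂‖_E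 < ∞. -/
open MeasureTheory Filter Set
open scoped ENNReal Classical

noncomputable section

/-- The closed-loop vector field `F((x,e,αh),t)` of the infinite-dimensional adaptive
system on `E = ℝⁿ × ℝˢ × L²(Θ,ν)` (equipped with the max norm):
`F = (f + g(∫Φαh dν − h), f_e + g_e(∫Φαh dν − h), −γ Φ(x,·)ᵀ g_eᵀ ∇Q)`. -/
def closedLoopField {n s d d₁ : ℕ} {Θ : Type*} [MeasurableSpace Θ] (ν : Measure Θ)
    (Φ : EuclideanSpace ℝ (Fin n) → Θ →
      (EuclideanSpace ℝ (Fin d₁) →L[ℝ] EuclideanSpace ℝ (Fin d)))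
    (f : EuclideanSpace ℝ (Fin n) → ℝ → EuclideanSpace ℝ (Fin n))
    (g : EuclideanSpace ℝ (Fin n) → ℝ →
      (EuclideanSpace ℝ (Fin d) →L[ℝ] EuclideanSpace ℝ (Fin n)))
    (h : EuclideanSpace ℝ (Fin n) → EuclideanSpace ℝ (Fin d))
    (fe : EuclideanSpace ℝ (Fin s) → ℝ → EuclideanSpace ℝ (Fin s))
    (ge : EuclideanSpace ℝ (Fin n) → ℝ →
      (EuclideanSpace ℝ (Fin d) →L[ℝ] EuclideanSpace ℝ (Fin s)))
    (gradQ : EuclideanSpace ℝ (Fin s) → ℝ → EuclideanSpace ℝ (Fin s))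
    (γ : ℝ)
    (z : EuclideanSpace ℝ (Fin n) × EuclideanSpace ℝ (Fin s) ×
      Lp (EuclideanSpace ℝ (Fin d₁)) 2 ν)
    (t : ℝ) :
    EuclideanSpace ℝ (Fin n) × EuclideanSpace ℝ (Fin s) ×
      Lp (EuclideanSpace ℝ (Fin d₁)) 2 ν :=
  ⟨f z.1 t + (g z.1 t) ((∫ θ, (Φ z.1 θ) (z.2.2 θ) ∂ν) - h z.1),
   fe z.2.1 t + (ge z.1 t) ((∫ θ, (Φ z.1 θ) (z.2.2 θ) ∂ν) - h z.1),
   if hmem : MemLp (fun θ => (-γ) • (ContinuousLinearMap.adjoint (Φ z.1 θ))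
       ((ContinuousLinearMap.adjoint (ge z.1 t)) (gradQ z.2.1 t))) 2 ν
   then hmem.toLp _ else 0⟩

/-- Lipschitz and bounded on the ball of radius `R`, uniformly for `t ∈ [0,T]`. -/
def LipBdd {E F : Type*} [NormedAddCommGroup E] [NormedAddCommGroup F] (R T : ℝ)
    (u : E → ℝ → F) : Prop :=
  ∃ C M : ℝ, 0 ≤ C ∧ 0 ≤ M ∧ ∀ t ∈ Set.Icc (0 : ℝ) T,
    (∀ x y : E, ‖x‖ ≤ R → ‖y‖ ≤ R → ‖u x t - u y t‖ ≤ C * ‖x - y‖) ∧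
    (∀ x : E, ‖x‖ ≤ R → ‖u x t‖ ≤ M)

section LipBddLemmas

variable {E F G H : Type*} [NormedAddCommGroup E] [NormedAddCommGroup F] [NormedAddCommGroup G]
  [NormedAddCommGroup H]

theorem LipBdd.of_loc {R T : ℝ} (hR : 0 < R) (hT : 0 < T) {f : E → ℝ → F}
    (h1 : LocLipschitzInX f) (h2 : LocBoundedInXUnifT f) : LipBdd R T f := by
  obtain ⟨C, hC⟩ := h1 T R hT hR
  obtain ⟨M, hM⟩ := h2 R hR
  refine ⟨|C|, |M|, abs_nonneg _, abs_nonneg _, fun t ht => ⟨fun x y hx hy => ?_, fun x hx => ?_⟩⟩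
  · exact (hC t ht x y hx hy).trans
      (mul_le_mul_of_nonneg_right (le_abs_self C) (norm_nonneg _))
  · exact (hM t ht.1 x hx).trans (le_abs_self M)

theorem LipBdd.comp {R T : ℝ} {f : F → ℝ → G} (hf : LipBdd R T f) (p : E → F)
    (hp : ∀ x y, ‖p x - p y‖ ≤ ‖x - y‖) (hp0 : ∀ x, ‖p x‖ ≤ ‖x‖) :
    LipBdd R T (fun x t => f (p x) t) := by
  obtain ⟨C, M, hC, hM, h⟩ := hf
  refine ⟨C, M, hC, hM, fun t ht => ⟨fun x y hx hy => ?_, fun x hx => ?_⟩⟩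
  · exact ((h t ht).1 _ _ ((hp0 x).trans hx) ((hp0 y).trans hy)).trans
      (mul_le_mul_of_nonneg_left (hp x y) hC)
  · exact (h t ht).2 _ ((hp0 x).trans hx)

theorem LipBdd.add {R T : ℝ} {u v : E → ℝ → F} (hu : LipBdd R T u) (hv : LipBdd R T v) :
    LipBdd R T (fun x t => u x t + v x t) := by
  obtain ⟨C, M, hC, hM, h⟩ := hu
  obtain ⟨C', M', hC', hM', h'⟩ := hv
  refine ⟨C + C', M + M', by positivity, by positivity,
    fun t ht => ⟨fun x y hx hy => ?_, fun x hx => ?_⟩⟩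
  · rw [add_sub_add_comm, add_mul]
    exact norm_add_le_of_le ((h t ht).1 x y hx hy) ((h' t ht).1 x y hx hy)
  · exact norm_add_le_of_le ((h t ht).2 x hx) ((h' t ht).2 x hx)

theorem LipBdd.neg {R T : ℝ} {u : E → ℝ → F} (hu : LipBdd R T u) :
    LipBdd R T (fun x t => - u x t) := by
  obtain ⟨C, M, hC, hM, h⟩ := hu
  refine ⟨C, M, hC, hM, fun t ht => ⟨fun x y hx hy => ?_, fun x hx => ?_⟩⟩
  · rw [neg_sub_neg, norm_sub_rev]
    exact (h t ht).1 x y hx hy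
  · rw [norm_neg]
    exact (h t ht).2 x hx

theorem LipBdd.sub {R T : ℝ} {u v : E → ℝ → F} (hu : LipBdd R T u) (hv : LipBdd R T v) :
    LipBdd R T (fun x t => u x t - v x t) := by
  simpa only [sub_eq_add_neg] using hu.add hv.neg

theorem LipBdd.prodMk {R T : ℝ} {u : E → ℝ → F} {v : E → ℝ → G} (hu : LipBdd R T u)
    (hv : LipBdd R T v) : LipBdd R T (fun x t => (u x t, v x t)) := by
  obtain ⟨C, M, hC, hM, h⟩ := hu
  obtain ⟨C', M', hC', hM', h'⟩ := hv
  refine ⟨C + C', M + M', by positivity, by positivity,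
    fun t ht => ⟨fun x y hx hy => ?_, fun x hx => ?_⟩⟩
  · have a := (h t ht).1 x y hx hy
    have b := (h' t ht).1 x y hx hy
    have c : 0 ≤ C * ‖x - y‖ := by positivity
    have e : 0 ≤ C' * ‖x - y‖ := by positivity
    rw [Prod.mk_sub_mk, Prod.norm_mk, add_mul]
    exact max_le (by linarith) (by linarith)
  · have a := (h t ht).2 x hx
    have b := (h' t ht).2 x hx
    rw [Prod.norm_mk]
    exact max_le (by linarith) (by linarith)

theorem LipBdd.bilin [NormedSpace ℝ F] [NormedSpace ℝ G] [NormedSpace ℝ H]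
    {R T : ℝ} (B : F →L[ℝ] G →L[ℝ] H) {u : E → ℝ → F} {v : E → ℝ → G} (hu : LipBdd R T u)
    (hv : LipBdd R T v) : LipBdd R T (fun x t => B (u x t) (v x t)) := by
  obtain ⟨C, M, hC, hM, h⟩ := hu
  obtain ⟨C', M', hC', hM', h'⟩ := hv
  refine ⟨‖B‖ * (C * M' + M * C'), ‖B‖ * M * M', by positivity, by positivity,
    fun t ht => ⟨fun x y hx hy => ?_, fun x hx => ?_⟩⟩
  · have e : B (u x t) (v x t) - B (u y t) (v y t)
        = B (u x t - u y t) (v x t) + B (u y t) (v x t - v y t) := by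
      simp
    rw [e]
    have h1 : ‖B (u x t - u y t) (v x t)‖ ≤ ‖B‖ * (C * ‖x - y‖) * M' := by
      refine (B.le_opNorm₂ _ _).trans ?_
      gcongr
      · exact (h t ht).1 x y hx hy
      · exact (h' t ht).2 x hx
    have h2 : ‖B (u y t) (v x t - v y t)‖ ≤ ‖B‖ * M * (C' * ‖x - y‖) := by
      refine (B.le_opNorm₂ _ _).trans ?_
      gcongr
      · exact (h t ht).2 y hy
      · exact (h' t ht).1 x y hx hy
    refine (norm_add_le_of_le h1 h2).trans (le_of_eq (by ring))
  · refine (B.le_opNorm₂ _ _).trans ?_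
    gcongr
    · exact (h t ht).2 x hx
    · exact (h' t ht).2 x hx

theorem LipBdd.clm [NormedSpace ℝ F] [NormedSpace ℝ G]
    {R T : ℝ} (L : F →L[ℝ] G) {u : E → ℝ → F} (hu : LipBdd R T u) :
    LipBdd R T (fun x t => L (u x t)) := by
  obtain ⟨C, M, hC, hM, h⟩ := hu
  refine ⟨‖L‖ * C, ‖L‖ * M, by positivity, by positivity,
    fun t ht => ⟨fun x y hx hy => ?_, fun x hx => ?_⟩⟩
  · rw [← map_sub, mul_assoc]
    exact L.le_opNorm_of_le ((h t ht).1 x y hx hy)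
  · exact L.le_opNorm_of_le ((h t ht).2 x hx)

end LipBddLemmas

/-- The real adjoint as a continuous linear map. -/
def adjR (a b : ℕ) : (EuclideanSpace ℝ (Fin a) →L[ℝ] EuclideanSpace ℝ (Fin b)) →L[ℝ]
    (EuclideanSpace ℝ (Fin b) →L[ℝ] EuclideanSpace ℝ (Fin a)) :=
  LinearMap.mkContinuous
    { toFun := fun A => ContinuousLinearMap.adjoint A
      map_add' := fun A B => map_add _ A B
      map_smul' := fun c A => by simp } 1
    (fun A => by simp)

theorem adjR_apply (a b : ℕ) (A : EuclideanSpace ℝ (Fin a) →L[ℝ] EuclideanSpace ℝ (Fin b)) :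
    adjR a b A = ContinuousLinearMap.adjoint A := rfl

theorem norm_toLp_two {Θ F : Type*} [MeasurableSpace Θ] {ν : Measure Θ} [NormedAddCommGroup F]
    {A : Θ → F} (hA : MemLp A 2 ν) : ‖hA.toLp A‖ = Real.sqrt (∫ θ, ‖A θ‖ ^ 2 ∂ν) := by
  rw [Lp.norm_toLp, hA.eLpNorm_eq_integral_rpow_norm (by norm_num) (by norm_num),
    ENNReal.toReal_ofReal (by positivity), Real.sqrt_eq_rpow]
  norm_num

set_option maxHeartbeats 4000000 in
/-- **Local Lipschitzness of the infinite-dimensional closed-loop vector field.**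
On the Banach space `E = ℝⁿ × ℝˢ × L²(Θ,ν;ℝ^{d₁})` with the max norm, the
closed-loop vector field `F(z,t)` is locally Lipschitz in `z`, uniformly over
compact time intervals. -/
theorem closedLoopField_locally_lipschitz
    {n s d d₁ : ℕ} {Θ : Type*} [MeasurableSpace Θ]
    (ν : Measure Θ) [IsProbabilityMeasure ν]
    (f : EuclideanSpace ℝ (Fin n) → ℝ → EuclideanSpace ℝ (Fin n))
    (g : EuclideanSpace ℝ (Fin n) → ℝ →
      (EuclideanSpace ℝ (Fin d) →L[ℝ] EuclideanSpace ℝ (Fin n)))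
    (h : EuclideanSpace ℝ (Fin n) → EuclideanSpace ℝ (Fin d))
    (fe : EuclideanSpace ℝ (Fin s) → ℝ → EuclideanSpace ℝ (Fin s))
    (ge : EuclideanSpace ℝ (Fin n) → ℝ →
      (EuclideanSpace ℝ (Fin d) →L[ℝ] EuclideanSpace ℝ (Fin s)))
    (gradQ : EuclideanSpace ℝ (Fin s) → ℝ → EuclideanSpace ℝ (Fin s))
    (γ : ℝ) (hγ : 0 < γ)
    -- regularity of the data
    (hf_lip : LocLipschitzInX f) (hf_bd : LocBoundedInXUnifT f)
    (hg_lip : LocLipschitzInX g) (hg_bd : LocBoundedInXUnifT g)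
    (hh_lip : LocLipschitzInX fun x (_ : ℝ) => h x)
    (hh_bd : LocBoundedInXUnifT fun x (_ : ℝ) => h x)
    (hfe_lip : LocLipschitzInX fe) (hfe_bd : LocBoundedInXUnifT fe)
    (hge_lip : LocLipschitzInX ge) (hge_bd : LocBoundedInXUnifT ge)
    (hgradQ_lip : LocLipschitzInX gradQ) (hgradQ_bd : LocBoundedInXUnifT gradQ)
    -- second moment regularity of Φ (Assumption 5)
    (Φ : EuclideanSpace ℝ (Fin n) → Θ →
      (EuclideanSpace ℝ (Fin d₁) →L[ℝ] EuclideanSpace ℝ (Fin d)))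
    (hΦ_meas : ∀ x : EuclideanSpace ℝ (Fin n), AEStronglyMeasurable (fun θ => Φ x θ) ν)
    (hΦ_sq : ∀ x : EuclideanSpace ℝ (Fin n), Integrable (fun θ => ‖Φ x θ‖ ^ 2) ν)
    (hΦ_lip : ∀ R : ℝ, 0 < R → ∃ C : ℝ, ∀ x y : EuclideanSpace ℝ (Fin n),
      ‖x‖ ≤ R → ‖y‖ ≤ R →
        Real.sqrt (∫ θ, ‖Φ x θ - Φ y θ‖ ^ 2 ∂ν) ≤ C * ‖x - y‖) :
    ∀ R T : ℝ, 0 < R → 0 < T → ∃ C : ℝ,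
      ∀ t ∈ Set.Icc (0 : ℝ) T,
      ∀ z₁ z₂ : EuclideanSpace ℝ (Fin n) × EuclideanSpace ℝ (Fin s) ×
          Lp (EuclideanSpace ℝ (Fin d₁)) 2 ν,
        ‖z₁‖ ≤ R → ‖z₂‖ ≤ R →
        ‖closedLoopField ν Φ f g h fe ge gradQ γ z₁ t -
            closedLoopField ν Φ f g h fe ge gradQ γ z₂ t‖ ≤ C * ‖z₁ - z₂‖ := by
  intro R T hR hT
  have hΦm : ∀ x, MemLp (Φ x) 2 ν := fun x =>
    (memLp_two_iff_integrable_sq_norm (hΦ_meas x)).2 (hΦ_sq x)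
  set φ := fun x => (hΦm x).toLp (Φ x) with hφ
  have hp1 : ∀ x y : EuclideanSpace ℝ (Fin n) × EuclideanSpace ℝ (Fin s) ×
      Lp (EuclideanSpace ℝ (Fin d₁)) 2 ν, ‖x.1 - y.1‖ ≤ ‖x - y‖ := fun x y => norm_fst_le (x - y)
  have hp2 : ∀ x y : EuclideanSpace ℝ (Fin n) × EuclideanSpace ℝ (Fin s) ×
      Lp (EuclideanSpace ℝ (Fin d₁)) 2 ν, ‖x.2.1 - y.2.1‖ ≤ ‖x - y‖ :=
    fun x y => (norm_fst_le (x - y).2).trans (norm_snd_le (x - y))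
  have hq1 : ∀ x : EuclideanSpace ℝ (Fin n) × EuclideanSpace ℝ (Fin s) ×
      Lp (EuclideanSpace ℝ (Fin d₁)) 2 ν, ‖x.1‖ ≤ ‖x‖ := fun x => norm_fst_le x
  have hq2 : ∀ x : EuclideanSpace ℝ (Fin n) × EuclideanSpace ℝ (Fin s) ×
      Lp (EuclideanSpace ℝ (Fin d₁)) 2 ν, ‖x.2.1‖ ≤ ‖x‖ :=
    fun x => (norm_fst_le x.2).trans (norm_snd_le x)
  have Lφ : LipBdd R T (fun x (_ : ℝ) => φ x) := by
    obtain ⟨C, hC⟩ := hΦ_lip R hR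
    have key : ∀ x y, ‖x‖ ≤ R → ‖y‖ ≤ R → ‖φ x - φ y‖ ≤ |C| * ‖x - y‖ := by
      intro x y hx hy
      simp only [hφ]
      rw [← MemLp.toLp_sub, norm_toLp_two]
      exact (hC x y hx hy).trans (mul_le_mul_of_nonneg_right (le_abs_self C) (norm_nonneg _))
    refine ⟨|C|, |C| * R + ‖φ 0‖, by positivity, by positivity,
      fun t ht => ⟨key, fun x hx => ?_⟩⟩
    have h1 := key x 0 hx (by simpa using hR.le)
    have h2 : ‖φ x‖ ≤ ‖φ x - φ 0‖ + ‖φ 0‖ := by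
      simpa using norm_add_le (φ x - φ 0) (φ 0)
    have h3 : |C| * ‖x - 0‖ ≤ |C| * R := by
      rw [sub_zero]
      gcongr
    linarith
  have Lφz := Lφ.comp _ hp1 hq1
  have Lα : LipBdd R T (fun (z : EuclideanSpace ℝ (Fin n) × EuclideanSpace ℝ (Fin s) ×
      Lp (EuclideanSpace ℝ (Fin d₁)) 2 ν) (_ : ℝ) => z.2.2) := by
    refine ⟨1, R, zero_le_one, hR.le, fun t ht => ⟨fun x y _ _ => ?_, fun x hx => ?_⟩⟩
    · rw [one_mul]
      exact (norm_snd_le (x - y).2).trans (norm_snd_le (x - y))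
    · exact ((norm_snd_le x.2).trans (norm_snd_le x)).trans hx
  have LI := Lφz.bilin ((ContinuousLinearMap.id ℝ
    (EuclideanSpace ℝ (Fin d₁) →L[ℝ] EuclideanSpace ℝ (Fin d))).lpPairing ν 2 2) Lα
  have Ih := LI.sub ((LipBdd.of_loc hR hT hh_lip hh_bd).comp _ hp1 hq1)
  have Lg := (LipBdd.of_loc hR hT hg_lip hg_bd).comp _ hp1 hq1
  have Lge := (LipBdd.of_loc hR hT hge_lip hge_bd).comp _ hp1 hq1
  have Lf := (LipBdd.of_loc hR hT hf_lip hf_bd).comp _ hp1 hq1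
  have Lfe := (LipBdd.of_loc hR hT hfe_lip hfe_bd).comp _ hp2 hq2
  have LQ := (LipBdd.of_loc hR hT hgradQ_lip hgradQ_bd).comp _ hp2 hq2
  have c1 := Lf.add (Lg.bilin (ContinuousLinearMap.id ℝ _) Ih)
  have c2 := Lfe.add (Lge.bilin (ContinuousLinearMap.id ℝ _) Ih)
  have c3 := (Lge.bilin (adjR d s) LQ).bilin
    (((-γ) • (adjR d₁ d).flip).compLpL₂ 2 ν) Lφz
  obtain ⟨C, M, hC, hM, H⟩ := c1.prodMk (c2.prodMk c3)
  refine ⟨C, fun t ht z₁ z₂ h₁ h₂ => ?_⟩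
  have eqF : ∀ z, closedLoopField ν Φ f g h fe ge gradQ γ z t = _ := fun z => by
    have hI : (ContinuousLinearMap.id ℝ
        (EuclideanSpace ℝ (Fin d₁) →L[ℝ] EuclideanSpace ℝ (Fin d))).lpPairing ν 2 2
          (φ z.1) z.2.2 = ∫ θ, (Φ z.1 θ) (z.2.2 θ) ∂ν := by
      rw [ContinuousLinearMap.lpPairing_eq_integral]
      apply integral_congr_ae
      filter_upwards [(hΦm z.1).coeFn_toLp] with θ hθ
      simp only [hφ, hθ, ContinuousLinearMap.id_apply]
    set w := (ContinuousLinearMap.adjoint (ge z.1 t)) (gradQ z.2.1 t) with hw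
    have hae : (((-γ) • (adjR d₁ d).flip).compLpL₂ 2 ν w (φ z.1) : Θ → _) =ᵐ[ν]
        fun θ => (-γ) • (ContinuousLinearMap.adjoint (Φ z.1 θ)) w := by
      rw [ContinuousLinearMap.compLpL₂_apply_apply]
      filter_upwards [(hΦm z.1).coeFn_toLp,
        ContinuousLinearMap.coeFn_compLp (((-γ) • (adjR d₁ d).flip) w) (φ z.1)] with θ hθ h2
      rw [h2]
      simp only [hφ, hθ]
      rfl
    have hm : MemLp (fun θ => (-γ) • (ContinuousLinearMap.adjoint (Φ z.1 θ)) w) 2 ν :=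
      (memLp_congr_ae hae).1 (Lp.memLp _)
    have h3 : (if hmem : MemLp (fun θ => (-γ) • (ContinuousLinearMap.adjoint (Φ z.1 θ)) w) 2 ν
        then hmem.toLp _ else 0) = ((-γ) • (adjR d₁ d).flip).compLpL₂ 2 ν w (φ z.1) := by
      rw [dif_pos hm]
      apply Lp.ext
      exact hm.coeFn_toLp.trans hae.symm
    unfold closedLoopField
    rw [← hw, h3, ← hI]
  rw [eqF, eqF]
  exact (H t ht).1 z₁ z₂ h₁ h₂

end
end
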